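/- For every finite simple graph G = (V,E) with no isolated vertices (every vertex has degree at least 1), E(G) ≤ 2·e₁₁ + √(2·(|V| − |L|)·(|E| + |L| − 3·e₁₁)). -/

import Mathlib

open Finset

namespace GraphEnergy

variable {V : Type*} [Fintype V] [DecidableEq V]

/-- The adjacency matrix of a simple graph over `ℝ` is Hermitian. -/
theorem adjMatrix_isHermitian (G : SimpleGraph V) [DecidableRel G.Adj] :
    (G.adjMatrix ℝ).IsHermitian := by
  ext i j
  simp [Matrix.conjTranspose_apply, SimpleGraph.adj_comm]

/-- The energy of a finite simple graph: the sum of the absolute values of the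
eigenvalues of its adjacency matrix. -/
noncomputable def energy (G : SimpleGraph V) [DecidableRel G.Adj] : ℝ :=
  ∑ i, |(adjMatrix_isHermitian G).eigenvalues i|

/-- The set of inner vertices: vertices of degree at least 2. -/
def innerVerts (G : SimpleGraph V) [DecidableRel G.Adj] : Finset V :=
  univ.filter (fun v => 2 ≤ G.degree v)

/-- The set of leaves: vertices of degree 1. -/
def leaves (G : SimpleGraph V) [DecidableRel G.Adj] : Finset V :=
  univ.filter (fun v => G.degree v = 1)

/-- The number of neighbors of `v` that are leaves. -/
def leafCount (G : SimpleGraph V) [DecidableRel G.Adj] (v : V) : ℕ :=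
  ((G.neighborFinset v).filter (fun w => G.degree w = 1)).card

open scoped Classical in
/-- The number of edges both of whose endpoints are leaves. -/
noncomputable def e11 (G : SimpleGraph V) [DecidableRel G.Adj] : ℕ :=
  (G.edgeFinset.filter (fun e => ∀ v ∈ e, G.degree v = 1)).card

open scoped Matrix in
/-- The energy is the pairing of the adjacency matrix with a symmetric orthogonal matrix. -/
theorem exists_energy_eq_sum (G : SimpleGraph V) [DecidableRel G.Adj] :
    ∃ S : Matrix V V ℝ, (∀ v w, S v w = S w v) ∧ (∀ v, ∑ w, S v w ^ 2 = 1) ∧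
      energy G = ∑ v, ∑ w, G.adjMatrix ℝ v w * S v w := by
  have hA := adjMatrix_isHermitian G
  set U : Matrix V V ℝ := (hA.eigenvectorUnitary : Matrix V V ℝ)
  set l : V → ℝ := hA.eigenvalues
  set d : V → ℝ := fun i => if 0 ≤ l i then 1 else -1 with hd
  have hdd : ∀ i, d i * d i = 1 := fun i => by simp only [hd]; split_ifs <;> norm_num
  have hdl : ∀ i, |l i| = l i * d i := fun i => by
    simp only [hd]
    split_ifs with hi
    · rw [abs_of_nonneg hi, mul_one]
    · rw [abs_of_neg (not_le.mp hi)]; ring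
  have hUU : Uᵀ * U = 1 := by
    have := Unitary.coe_star_mul_self hA.eigenvectorUnitary
    rwa [Matrix.star_eq_conjTranspose, Matrix.conjTranspose_eq_transpose_of_trivial] at this
  have hUU' : U * Uᵀ = 1 := mul_eq_one_comm.mp hUU
  have hspec : G.adjMatrix ℝ = U * Matrix.diagonal l * Uᵀ := by
    have := hA.spectral_theorem
    rw [Unitary.conjStarAlgAut_apply, Matrix.star_eq_conjTranspose,
      Matrix.conjTranspose_eq_transpose_of_trivial] at this
    exact this
  set S : Matrix V V ℝ := U * Matrix.diagonal d * Uᵀ with hS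
  have hST : Sᵀ = S := by
    simp [hS, Matrix.transpose_mul, Matrix.mul_assoc]
  have hSS : S * Sᵀ = 1 := by
    have hD : Matrix.diagonal d * Matrix.diagonal d = 1 := by
      rw [Matrix.diagonal_mul_diagonal]
      simp [hdd]
    calc S * Sᵀ = U * (Matrix.diagonal d * (Uᵀ * U) * Matrix.diagonal d) * Uᵀ := by
          rw [hST, hS]; simp only [Matrix.mul_assoc]
      _ = 1 := by rw [hUU, Matrix.mul_one, hD, Matrix.mul_one, hUU']
  refine ⟨S, fun v w => congrFun₂ hST.symm v w, fun v => ?_, ?_⟩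
  · have := congrFun₂ hSS v v
    simpa [Matrix.mul_apply, sq] using this
  · have htr : (G.adjMatrix ℝ * Sᵀ).trace = ∑ i, l i * d i := by
      calc (G.adjMatrix ℝ * Sᵀ).trace
          = (U * (Matrix.diagonal l * (Uᵀ * U) * Matrix.diagonal d * Uᵀ)).trace := by
            rw [hST, hspec, hS]; simp only [Matrix.mul_assoc]
        _ = (Matrix.diagonal l * Matrix.diagonal d * (Uᵀ * U)).trace := by
            rw [Matrix.trace_mul_comm, hUU, Matrix.mul_one, Matrix.mul_assoc, hUU]
        _ = ∑ i, l i * d i := by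
            rw [hUU, Matrix.mul_one, Matrix.diagonal_mul_diagonal, Matrix.trace_diagonal]
    rw [energy, Finset.sum_congr rfl fun i _ => hdl i, ← htr]
    simp [Matrix.trace, Matrix.mul_apply]

/-- The sum of the row of the adjacency matrix at a vertex is its degree. -/
theorem sum_adjMatrix_row (G : SimpleGraph V) [DecidableRel G.Adj] (v : V) :
    ∑ w, G.adjMatrix ℝ v w = G.degree v := by
  simp [SimpleGraph.adjMatrix_apply, ← SimpleGraph.card_neighborFinset_eq_degree,
    SimpleGraph.neighborFinset_eq_filter]

/-- The sum of all entries of the adjacency matrix is twice the number of edges. -/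
theorem sum_adjMatrix (G : SimpleGraph V) [DecidableRel G.Adj] :
    ∑ v, ∑ w, G.adjMatrix ℝ v w = 2 * (G.edgeFinset.card : ℝ) := by
  simp_rw [sum_adjMatrix_row]
  exact_mod_cast G.sum_degrees_eq_twice_card_edges

/-- The indicator function of the set of leaves. -/
def leafInd (G : SimpleGraph V) [DecidableRel G.Adj] (v : V) : ℝ :=
  if G.degree v = 1 then 1 else 0

theorem sum_leafInd (G : SimpleGraph V) [DecidableRel G.Adj] :
    ∑ v, leafInd G v = ((leaves G).card : ℝ) := by
  simp [leafInd, leaves]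

theorem sum_adjMatrix_mul_leafInd_left (G : SimpleGraph V) [DecidableRel G.Adj] :
    ∑ v, ∑ w, G.adjMatrix ℝ v w * leafInd G v = ((leaves G).card : ℝ) := by
  simp_rw [← Finset.sum_mul, sum_adjMatrix_row, ← sum_leafInd]
  refine Finset.sum_congr rfl fun v _ => ?_
  unfold leafInd
  split_ifs with hv <;> simp [hv]

theorem sum_adjMatrix_mul_leafInd_right (G : SimpleGraph V) [DecidableRel G.Adj] :
    ∑ v, ∑ w, G.adjMatrix ℝ v w * leafInd G w = ((leaves G).card : ℝ) := by
  rw [← sum_adjMatrix_mul_leafInd_left, Finset.sum_comm]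
  simp [SimpleGraph.adjMatrix_apply, SimpleGraph.adj_comm]

theorem sum_adjMatrix_mul_leafInd_mul_leafInd (G : SimpleGraph V) [DecidableRel G.Adj] :
    ∑ v, ∑ w, G.adjMatrix ℝ v w * (leafInd G v * leafInd G w) = 2 * (e11 G : ℝ) := by
  classical
  let H : SimpleGraph V :=
    { Adj := fun v w => G.Adj v w ∧ G.degree v = 1 ∧ G.degree w = 1
      symm := ⟨fun _ _ hvw => ⟨hvw.1.symm, hvw.2.2, hvw.2.1⟩⟩
      loopless := ⟨fun v hv => G.loopless.irrefl v hv.1⟩ }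
  have hcard : e11 G = H.edgeFinset.card := by
    unfold e11
    congr 1
    ext e
    induction e with
    | _ v w => simp [H]
  rw [hcard, ← sum_adjMatrix H]
  refine Finset.sum_congr rfl fun v _ => Finset.sum_congr rfl fun w _ => ?_
  simp only [SimpleGraph.adjMatrix_apply, leafInd, H]
  split_ifs <;> simp_all

/-- For a graph with no isolated vertices,
`E(G) ≤ 2 e₁₁ + √(2 (|V| - |L|)(|E| + |L| - 3 e₁₁))`. -/
theorem energy_le_global_bound (G : SimpleGraph V) [DecidableRel G.Adj]
    (h : ∀ v : V, 1 ≤ G.degree v) :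
    energy G ≤ 2 * (e11 G : ℝ) +
      Real.sqrt (2 * ((Fintype.card V : ℝ) - ((leaves G).card : ℝ)) *
        ((G.edgeFinset.card : ℝ) + ((leaves G).card : ℝ) - 3 * (e11 G : ℝ))) := by
  obtain ⟨S, hsymm, hrow, hE⟩ := exists_energy_eq_sum G
  set A := G.adjMatrix ℝ with hA
  set l := leafInd G with hl
  have hA01 : ∀ v w, A v w = 0 ∨ A v w = 1 := fun v w => by
    rw [hA, SimpleGraph.adjMatrix_apply]; split_ifs <;> simp
  have hAsymm : ∀ v w, A v w = A w v := fun v w => by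
    simp [hA, SimpleGraph.adjMatrix_apply, SimpleGraph.adj_comm]
  have hl01 : ∀ v, l v = 0 ∨ l v = 1 := fun v => by
    rw [hl, leafInd]; split_ifs <;> simp
  have hS1 : ∀ v w, S v w ≤ 1 := fun v w => by
    have : S v w ^ 2 ≤ 1 := by
      rw [← hrow v]
      exact Finset.single_le_sum (f := fun w => S v w ^ 2) (fun _ _ => sq_nonneg _) (mem_univ w)
    nlinarith [sq_nonneg (S v w - 1)]
  -- Half of every edge is charged to each end, except that pendant edges go to the inner end.
  have hsplit : energy G = ∑ v, ∑ w, A v w * (1 - l v + l w) * S v w := by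
    have hswap : ∑ v, ∑ w, A v w * l w * S v w = ∑ v, ∑ w, A v w * l v * S v w := by
      rw [Finset.sum_comm]
      refine Finset.sum_congr rfl fun v _ => Finset.sum_congr rfl fun w _ => ?_
      rw [hAsymm, hsymm]
    have : ∑ v, ∑ w, A v w * (1 - l v + l w) * S v w = ∑ v, ∑ w, A v w * S v w
        - ∑ v, ∑ w, A v w * l v * S v w + ∑ v, ∑ w, A v w * l w * S v w := by
      simp only [← Finset.sum_sub_distrib, ← Finset.sum_add_distrib]
      refine Finset.sum_congr rfl fun v _ => Finset.sum_congr rfl fun w _ => ?_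
      ring
    rw [this, hE, hswap]
    ring
  set q : V → ℝ := fun v => ∑ w, A v w * (1 + 3 * l w) with hq
  have hq0 : ∀ v, 0 ≤ q v := fun v => Finset.sum_nonneg fun w _ => by
    rcases hA01 v w with h1 | h1 <;> rcases hl01 w with h2 | h2 <;> rw [h1, h2] <;> norm_num
  have hvertex : ∀ v, ∑ w, A v w * (1 - l v + l w) * S v w ≤
      ∑ w, A v w * (l v * l w) + (1 - l v) * √(q v) := fun v => by
    rcases hl01 v with hv | hv
    · have hcs := Real.sum_mul_le_sqrt_mul_sqrt univ (fun w => A v w * (1 + l w)) (S v)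
      rw [hrow, Real.sqrt_one, mul_one] at hcs
      have hsq : ∑ w, (A v w * (1 + l w)) ^ 2 = q v := Finset.sum_congr rfl fun w _ => by
        rcases hA01 v w with h1 | h1 <;> rcases hl01 w with h2 | h2 <;> rw [h1, h2] <;> norm_num
      rw [hsq] at hcs
      simpa [hv] using hcs
    · rw [hv, sub_self, zero_mul, add_zero]
      refine Finset.sum_le_sum fun w _ => ?_
      have := hS1 v w
      rcases hA01 v w with h1 | h1 <;> rcases hl01 w with h2 | h2 <;> rw [h1, h2] <;> simp [this]
  have hcard : ∑ v, (1 - l v) ^ 2 = (Fintype.card V : ℝ) - ((leaves G).card : ℝ) := by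
    rw [← sum_leafInd, ← hl]
    calc ∑ v, (1 - l v) ^ 2 = ∑ v, (1 - l v) := Finset.sum_congr rfl fun v _ => by
          rcases hl01 v with h1 | h1 <;> rw [h1] <;> norm_num
      _ = _ := by simp [Finset.sum_sub_distrib]
  have hqsum : ∑ v, ((1 - l v) * √(q v)) ^ 2 =
      2 * ((G.edgeFinset.card : ℝ) + ((leaves G).card : ℝ) - 3 * (e11 G : ℝ)) := by
    calc ∑ v, ((1 - l v) * √(q v)) ^ 2 = ∑ v, (∑ w, A v w - ∑ w, A v w * l v
          + 3 * ∑ w, A v w * l w - 3 * ∑ w, A v w * (l v * l w)) := by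
          refine Finset.sum_congr rfl fun v _ => ?_
          have hidem : (1 - l v) ^ 2 = 1 - l v := by
            rcases hl01 v with h1 | h1 <;> rw [h1] <;> norm_num
          rw [mul_pow, Real.sq_sqrt (hq0 v), hidem]
          simp only [hq, Finset.mul_sum, ← Finset.sum_sub_distrib, ← Finset.sum_add_distrib]
          exact Finset.sum_congr rfl fun w _ => by ring
      _ = _ := by
          rw [Finset.sum_sub_distrib, Finset.sum_add_distrib, Finset.sum_sub_distrib,
            ← Finset.mul_sum, ← Finset.mul_sum, sum_adjMatrix, sum_adjMatrix_mul_leafInd_left,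
            sum_adjMatrix_mul_leafInd_right, sum_adjMatrix_mul_leafInd_mul_leafInd]
          ring
  have hcs := Real.sum_mul_le_sqrt_mul_sqrt univ (fun v => 1 - l v) (fun v => (1 - l v) * √(q v))
  rw [hcard, hqsum, ← Real.sqrt_mul (hcard ▸ Finset.sum_nonneg fun _ _ => sq_nonneg _)] at hcs
  have hinner : ∑ v, (1 - l v) * ((1 - l v) * √(q v)) = ∑ v, (1 - l v) * √(q v) :=
    Finset.sum_congr rfl fun v _ => by
      rcases hl01 v with h1 | h1 <;> rw [h1] <;> norm_num
  rw [hinner] at hcs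
  calc energy G ≤ ∑ v, (∑ w, A v w * (l v * l w) + (1 - l v) * √(q v)) :=
        hsplit ▸ Finset.sum_le_sum fun v _ => hvertex v
    _ = 2 * (e11 G : ℝ) + ∑ v, (1 - l v) * √(q v) := by
        rw [Finset.sum_add_distrib, sum_adjMatrix_mul_leafInd_mul_leafInd]
    _ ≤ _ := by
        refine add_le_add le_rfl (hcs.trans_eq ?_)
        congr 1
        ring

end GraphEnergy
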